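/- Let h ∈ ℝ² and let α : I → ℝ be measurable. Then the magnetoelastic energy E(ϑ) = ∫₀¹ ( (1/2)(ϑ')² − h·m(ϑ+α) ) has a minimizer ϑ ∈ H^1_{0L}(I). Every such minimizer is a weak solution of the state equation −ϑ'' − h·Dm(α+ϑ) = 0 in I, ϑ(0)=0, ϑ'(1)=0. If |h| < c_p^{-2} = π²/4, the minimizer is unique (indeed the weak solution of the state equation is unique). Finally, if α ∈ H¹(I), then any weak solution ϑ belongs to H³(I). -/

import Mathlib

open MeasureTheory Set

noncomputable def edot (p q : ℝ × ℝ) : ℝ := p.1 * q.1 + p.2 * q.2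
noncomputable def enorm2 (p : ℝ × ℝ) : ℝ := Real.sqrt (p.1 ^ 2 + p.2 ^ 2)
noncomputable def mvec (v : ℝ) : ℝ × ℝ := (Real.cos v, Real.sin v)
noncomputable def Dmvec (v : ℝ) : ℝ × ℝ := (-Real.sin v, Real.cos v)

/-- The space `H^1_{0L}(I)`, `I = (0,1)`. -/
structure H1L where
  f : ℝ → ℝ
  f' : ℝ → ℝ
  int : IntervalIntegrable f' volume 0 1
  sq : IntervalIntegrable (fun s => (f' s) ^ 2) volume 0 1
  repr : ∀ t ∈ Icc (0 : ℝ) 1, f t = ∫ s in (0 : ℝ)..t, f' s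

/-- The magnetoelastic energy `E(ϑ) = ∫₀¹ ( (1/2)(ϑ')² − h·m(ϑ+α) )`. -/
noncomputable def energy (h : ℝ × ℝ) (α : ℝ → ℝ) (v : H1L) : ℝ :=
  ∫ s in (0 : ℝ)..1, ((v.f' s) ^ 2 / 2 - edot h (mvec (v.f s + α s)))

/-- Weak solution of the state equation `-ϑ'' − h·Dm(α+ϑ) = 0`, `ϑ(0)=0`, `ϑ'(1)=0`. -/
def IsStateSol (h : ℝ × ℝ) (α : ℝ → ℝ) (v : H1L) : Prop :=
  ∀ w : H1L,
    (∫ s in (0 : ℝ)..1, v.f' s * w.f' s)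
      - ∫ s in (0 : ℝ)..1, edot h (Dmvec (α s + v.f s)) * w.f s = 0

/-- `v ∈ H³(I)`: `v` has three weak derivatives, the last one square integrable. -/
def InH3 (v : H1L) : Prop :=
  ∃ u1 u2 u3 : ℝ → ℝ,
    IntervalIntegrable u2 volume 0 1 ∧ IntervalIntegrable u3 volume 0 1 ∧
    IntervalIntegrable (fun s => (u3 s) ^ 2) volume 0 1 ∧
    (∀ t ∈ Icc (0 : ℝ) 1, v.f t = ∫ s in (0 : ℝ)..t, u1 s) ∧
    (∀ t ∈ Icc (0 : ℝ) 1, u1 t = u1 0 + ∫ s in (0 : ℝ)..t, u2 s) ∧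
    (∀ t ∈ Icc (0 : ℝ) 1, u2 t = u2 0 + ∫ s in (0 : ℝ)..t, u3 s)


open Filter Topology

section FieldEnergy

lemma hasDerivAt_edot_mvec (h : ℝ × ℝ) (x : ℝ) :
    HasDerivAt (fun t => edot h (mvec t)) (edot h (Dmvec x)) x := by
  simpa [edot, mvec, Dmvec] using
    ((Real.hasDerivAt_cos x).const_mul h.1).fun_add ((Real.hasDerivAt_sin x).const_mul h.2)

lemma hasDerivAt_edot_Dmvec (h : ℝ × ℝ) (x : ℝ) :
    HasDerivAt (fun t => edot h (Dmvec t)) (-edot h (mvec x)) x := by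
  have := ((Real.hasDerivAt_sin x).fun_neg.const_mul h.1).fun_add
    ((Real.hasDerivAt_cos x).const_mul h.2)
  refine this.congr_deriv ?_
  simp only [edot, mvec]
  ring

lemma continuous_edot_mvec (h : ℝ × ℝ) : Continuous fun t => edot h (mvec t) :=
  continuous_iff_continuousAt.2 fun x => (hasDerivAt_edot_mvec h x).continuousAt

lemma continuous_edot_Dmvec (h : ℝ × ℝ) : Continuous fun t => edot h (Dmvec t) :=
  continuous_iff_continuousAt.2 fun x => (hasDerivAt_edot_Dmvec h x).continuousAt

lemma enorm2_nonneg (h : ℝ × ℝ) : 0 ≤ enorm2 h := Real.sqrt_nonneg _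

lemma abs_edot_mvec_le (h : ℝ × ℝ) (x : ℝ) : |edot h (mvec x)| ≤ enorm2 h := by
  refine Real.abs_le_sqrt ?_
  simp only [edot, mvec]
  have e := Real.sin_sq_add_cos_sq x
  nlinarith [sq_nonneg (h.1 * Real.sin x - h.2 * Real.cos x)]

lemma abs_edot_Dmvec_le (h : ℝ × ℝ) (x : ℝ) : |edot h (Dmvec x)| ≤ enorm2 h := by
  refine Real.abs_le_sqrt ?_
  simp only [edot, Dmvec]
  have e := Real.sin_sq_add_cos_sq x
  nlinarith [sq_nonneg (h.1 * Real.cos x + h.2 * Real.sin x)]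

lemma abs_edot_mvec_sub_le (h : ℝ × ℝ) (x y : ℝ) :
    |edot h (mvec x) - edot h (mvec y)| ≤ enorm2 h * |x - y| := by
  simpa using Convex.norm_image_sub_le_of_norm_hasDerivWithin_le
    (fun z _ => (hasDerivAt_edot_mvec h z).hasDerivWithinAt) (fun z _ => abs_edot_Dmvec_le h z)
    convex_univ (mem_univ y) (mem_univ x)

lemma abs_edot_Dmvec_sub_le (h : ℝ × ℝ) (x y : ℝ) :
    |edot h (Dmvec x) - edot h (Dmvec y)| ≤ enorm2 h * |x - y| := by
  simpa using Convex.norm_image_sub_le_of_norm_hasDerivWithin_le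
    (fun z _ => (hasDerivAt_edot_Dmvec h z).hasDerivWithinAt)
    (fun z _ => (abs_neg _).trans_le (abs_edot_mvec_le h z))
    convex_univ (mem_univ y) (mem_univ x)

lemma abs_edot_mvec_taylor_le (h : ℝ × ℝ) (x y : ℝ) :
    |edot h (mvec (x + y)) - edot h (mvec x) - edot h (Dmvec x) * y| ≤ enorm2 h * y ^ 2 := by
  have key := Convex.norm_image_sub_le_of_norm_hasDerivWithin_le
    (f := fun t => edot h (mvec (x + t)) - edot h (Dmvec x) * t)
    (f' := fun t => edot h (Dmvec (x + t)) - edot h (Dmvec x)) (C := enorm2 h * |y|)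
    (s := uIcc 0 y) (x := 0) (y := y)
    (fun z _ => ?_) (fun z hz => ?_) (convex_uIcc 0 y) left_mem_uIcc right_mem_uIcc
  · simp only [add_zero, mul_zero, sub_zero, Real.norm_eq_abs] at key
    rw [mul_assoc, abs_mul_abs_self, ← sq] at key
    convert key using 2
    ring
  · have h1 := (hasDerivAt_edot_mvec h (x + z)).comp_const_add x z
    have h2 := (hasDerivAt_id z).const_mul (edot h (Dmvec x))
    simpa using (h1.fun_sub h2).hasDerivWithinAt
  · refine (abs_edot_Dmvec_sub_le h _ _).trans ?_
    have := abs_sub_left_of_mem_uIcc hz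
    rw [add_sub_cancel_left]
    simp only [sub_zero] at this
    exact mul_le_mul_of_nonneg_left this (enorm2_nonneg h)

end FieldEnergy

section Minimization

variable {X Y : Type*} [NormedAddCommGroup X] [InnerProductSpace ℝ X]
  [NormedAddCommGroup Y] [NormedSpace ℝ Y]

/-- Almost minimizers of a compact Lipschitz perturbation of the quadratic energy are close. -/
lemma norm_sub_sq_le_of_lipschitz_perturbation (T : X →L[ℝ] Y) {F : Y → ℝ} {L : NNReal}
    (hF : LipschitzWith L F) {m : ℝ} (hm : ∀ w, m ≤ ‖w‖ ^ 2 / 2 - F (T w)) (u w : X) :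
    ‖u - w‖ ^ 2 ≤ 4 * (‖u‖ ^ 2 / 2 - F (T u) - m) + 4 * (‖w‖ ^ 2 / 2 - F (T w) - m)
      + 4 * L * dist (T u) (T w) := by
  have hp := parallelogram_law_with_norm ℝ u w
  have hz := hm ((1 / 2 : ℝ) • (u + w))
  have hn : ‖(1 / 2 : ℝ) • (u + w)‖ = ‖u + w‖ / 2 := by
    rw [norm_smul]; norm_num; ring
  have d1 : dist (T u) (T ((1 / 2 : ℝ) • (u + w))) = dist (T u) (T w) / 2 := by
    rw [dist_eq_norm, dist_eq_norm, ← map_sub, ← map_sub,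
      show u - (1 / 2 : ℝ) • (u + w) = (1 / 2 : ℝ) • (u - w) by module, map_smul, norm_smul]
    norm_num; ring
  have d2 : dist (T w) (T ((1 / 2 : ℝ) • (u + w))) = dist (T u) (T w) / 2 := by
    rw [dist_eq_norm, dist_comm, dist_eq_norm, ← map_sub, ← map_sub,
      show w - (1 / 2 : ℝ) • (u + w) = (1 / 2 : ℝ) • (w - u) by module, map_smul, norm_smul]
    norm_num; ring
  have f1 := (le_abs_self _).trans (hF.dist_le_mul (T u) (T ((1 / 2 : ℝ) • (u + w))))
  have f2 := (le_abs_self _).trans (hF.dist_le_mul (T w) (T ((1 / 2 : ℝ) • (u + w))))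
  rw [d1] at f1
  rw [d2] at f2
  rw [hn] at hz
  nlinarith

/-- The quadratic energy perturbed by a Lipschitz function, bounded above, of a compact linear
image attains its minimum. -/
lemma exists_minimizer_of_isCompactOperator [CompleteSpace X] (T : X →L[ℝ] Y)
    (hT : IsCompactOperator T) {F : Y → ℝ} {L : NNReal} (hF : LipschitzWith L F) {M : ℝ}
    (hM : ∀ y, F y ≤ M) :
    ∃ u, ∀ w, ‖u‖ ^ 2 / 2 - F (T u) ≤ ‖w‖ ^ 2 / 2 - F (T w) := by
  set J : X → ℝ := fun w => ‖w‖ ^ 2 / 2 - F (T w) with hJ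
  have hJc : Continuous J :=
    ((continuous_norm.pow 2).div_const 2).sub (hF.continuous.comp T.continuous)
  have hbdd : BddBelow (range J) := by
    refine ⟨-M, ?_⟩
    rintro _ ⟨w, rfl⟩
    have := hM (T w)
    have := sq_nonneg ‖w‖
    simp only [hJ]
    linarith
  have hm : ∀ w, sInf (range J) ≤ J w := fun w => csInf_le hbdd (mem_range_self w)
  obtain ⟨a, -, ha, hamem⟩ := exists_seq_tendsto_sInf (range_nonempty J) hbdd
  choose u hu using hamem
  set m := sInf (range J)
  have hu' : Tendsto (fun n => J (u n)) atTop (𝓝 m) := by simpa only [hu] using ha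
  obtain ⟨B, hB⟩ := hu'.bddAbove_range
  have hball : ∀ n, T (u n) ∈ closure (T '' Metric.closedBall 0 (√(2 * (B + M)))) := fun n => by
    refine subset_closure ⟨u n, ?_, rfl⟩
    rw [mem_closedBall_zero_iff]
    refine Real.le_sqrt_of_sq_le ?_
    have h1 : J (u n) ≤ B := hB (mem_range_self n)
    have h2 := hM (T (u n))
    simp only [hJ] at h1
    linarith
  have hK : IsCompact (closure (T '' Metric.closedBall 0 (√(2 * (B + M))))) :=
    IsCompactOperator.isCompact_closure_image_closedBall (f := (T : X →ₗ[ℝ] Y)) hT _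
  obtain ⟨y, -, φ, hφ, hy⟩ := hK.tendsto_subseq hball
  have hJφ : Tendsto (fun n => J (u (φ n)) - m) atTop (𝓝 0) := by
    simpa using (hu'.comp hφ.tendsto_atTop).sub_const m
  have hcauchy : CauchySeq (u ∘ φ) := by
    have hTc : Tendsto (fun p : ℕ × ℕ => dist (T (u (φ p.1))) (T (u (φ p.2)))) atTop (𝓝 0) :=
      cauchySeq_iff_tendsto_dist_atTop_0.1 hy.cauchySeq
    rw [cauchySeq_iff_tendsto_dist_atTop_0]
    have h1 : Tendsto (fun p : ℕ × ℕ => 4 * (J (u (φ p.1)) - m) + 4 * (J (u (φ p.2)) - m)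
        + 4 * L * dist (T (u (φ p.1))) (T (u (φ p.2)))) atTop (𝓝 0) := by
      rw [← prod_atTop_atTop_eq] at hTc ⊢
      simpa using (((hJφ.comp tendsto_fst).const_mul 4).add
        ((hJφ.comp tendsto_snd).const_mul 4)).add (hTc.const_mul (4 * (L : ℝ)))
    have h2 : Tendsto (fun p : ℕ × ℕ => ‖u (φ p.1) - u (φ p.2)‖ ^ 2) atTop (𝓝 0) :=
      squeeze_zero (fun _ => sq_nonneg _)
        (fun p => norm_sub_sq_le_of_lipschitz_perturbation T hF hm _ _) h1
    simpa [Real.sqrt_sq, dist_eq_norm] using h2.sqrt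
  obtain ⟨v, hv⟩ := cauchySeq_tendsto_of_complete hcauchy
  have hJv : J v = m :=
    tendsto_nhds_unique ((hJc.tendsto v).comp hv) (hu'.comp hφ.tendsto_atTop)
  exact ⟨v, fun w => hJv.trans_le (hm w)⟩

end Minimization

section UnitInterval

lemma integral_unit_eq (f : ℝ → ℝ) :
    ∫ s in (0 : ℝ)..1, f s = ∫ s, f s ∂volume.restrict (Ioc (0 : ℝ) 1) :=
  intervalIntegral.integral_of_le zero_le_one

lemma intervalIntegrable_unit_iff {f : ℝ → ℝ} :
    IntervalIntegrable f volume 0 1 ↔ Integrable f (volume.restrict (Ioc (0 : ℝ) 1)) :=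
  intervalIntegrable_iff_integrableOn_Ioc_of_le zero_le_one

lemma intervalIntegrable_sq_iff_memLp {f : ℝ → ℝ} (hf : IntervalIntegrable f volume 0 1) :
    IntervalIntegrable (fun s => f s ^ 2) volume 0 1 ↔
      MemLp f 2 (volume.restrict (Ioc (0 : ℝ) 1)) := by
  rw [memLp_two_iff_integrable_sq (intervalIntegrable_unit_iff.1 hf).aestronglyMeasurable,
    intervalIntegrable_unit_iff]

lemma intervalIntegrable_of_memLp {f : ℝ → ℝ} (hf : MemLp f 2 (volume.restrict (Ioc (0 : ℝ) 1))) :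
    IntervalIntegrable f volume 0 1 :=
  intervalIntegrable_unit_iff.2 (hf.integrable one_le_two)

lemma ae_hasDerivAt_primitive {p : ℝ → ℝ} (hp : IntervalIntegrable p volume 0 1) :
    ∀ᵐ x, x ∈ uIcc (0 : ℝ) 1 → HasDerivAt (fun t => ∫ s in (0 : ℝ)..t, p s) (p x) x := by
  filter_upwards [hp.ae_hasDerivAt_integral] with x hx hx1 using hx hx1 0 left_mem_uIcc

lemma AbsolutelyContinuousOnInterval.integral_eq_sub_of_ae_hasDerivAt {F F' : ℝ → ℝ} {a b : ℝ}
    (hF : AbsolutelyContinuousOnInterval F a b)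
    (hF' : ∀ᵐ x, x ∈ uIcc a b → HasDerivAt F (F' x) x) :
    ∫ x in a..b, F' x = F b - F a := by
  rw [← hF.integral_deriv_eq_sub]
  refine intervalIntegral.integral_congr_ae ?_
  filter_upwards [hF'] with x hx hx1 using (hx (uIoc_subset_uIcc hx1)).deriv.symm

/-- Integration by parts for primitives of integrable functions. -/
lemma integral_primitive_mul_add {p q : ℝ → ℝ} (hp : IntervalIntegrable p volume 0 1)
    (hq : IntervalIntegrable q volume 0 1) :
    ∫ t in (0 : ℝ)..1, (p t * (∫ s in (0 : ℝ)..t, q s) + (∫ s in (0 : ℝ)..t, p s) * q t) =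
      (∫ s in (0 : ℝ)..1, p s) * ∫ s in (0 : ℝ)..1, q s := by
  have hP := hp.absolutelyContinuousOnInterval_intervalIntegral (c := 0) left_mem_uIcc
  have hQ := hq.absolutelyContinuousOnInterval_intervalIntegral (c := 0) left_mem_uIcc
  rw [(hP.fun_mul hQ).integral_eq_sub_of_ae_hasDerivAt]
  · simp
  · filter_upwards [ae_hasDerivAt_primitive hp, ae_hasDerivAt_primitive hq] with x h1 h2 hx
    exact (h1 hx).fun_mul (h2 hx)

/-- The chain rule for a Lipschitz differentiable function of a primitive. -/
lemma comp_eq_add_integral {φ φ' : ℝ → ℝ} {K : NNReal} (hφ : ∀ x, HasDerivAt φ (φ' x) x)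
    (hK : LipschitzWith K φ) {b b' : ℝ → ℝ} (hb' : IntervalIntegrable b' volume 0 1)
    (hb : ∀ t ∈ Icc (0 : ℝ) 1, b t = b 0 + ∫ s in (0 : ℝ)..t, b' s) :
    ∀ t ∈ Icc (0 : ℝ) 1, φ (b t) = φ (b 0) + ∫ s in (0 : ℝ)..t, φ' (b s) * b' s := by
  intro t ht
  have hsub : uIcc 0 t ⊆ uIcc (0 : ℝ) 1 := by
    rw [uIcc_of_le ht.1, uIcc_of_le zero_le_one]
    exact Icc_subset_Icc_right ht.2
  set B : ℝ → ℝ := fun t => b 0 + ∫ s in (0 : ℝ)..t, b' s with hB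
  have hBac : AbsolutelyContinuousOnInterval B 0 t := by
    have hc : AbsolutelyContinuousOnInterval (fun _ : ℝ => b 0) 0 1 :=
      (LipschitzWith.const (b 0)).lipschitzOnWith.absolutelyContinuousOnInterval
    exact (hc.fun_add
      (hb'.absolutelyContinuousOnInterval_intervalIntegral left_mem_uIcc)).mono hsub
  have hφB : AbsolutelyContinuousOnInterval (fun t => φ (B t)) 0 t := by
    have h1 : Tendsto _ _ _ := hBac
    refine squeeze_zero (fun _ => Finset.sum_nonneg fun _ _ => dist_nonneg) (fun E => ?_)
      (by simpa using h1.const_mul (K : ℝ))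
    rw [Finset.mul_sum]
    exact Finset.sum_le_sum fun i _ => hK.dist_le_mul _ _
  have hint := hφB.integral_eq_sub_of_ae_hasDerivAt (F' := fun s => φ' (B s) * b' s) (by
    filter_upwards [ae_hasDerivAt_primitive hb'] with x hx hx1
    exact (hφ (B x)).comp x ((hx (hsub hx1)).const_add (b 0)))
  have hcongr : ∫ s in (0 : ℝ)..t, φ' (b s) * b' s = ∫ s in (0 : ℝ)..t, φ' (B s) * b' s := by
    refine intervalIntegral.integral_congr fun s hs => ?_
    have := hsub hs
    rw [uIcc_of_le zero_le_one] at this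
    simp only [hb s this, hB]
  rw [hcongr, hint]
  have h0 : B 0 = b 0 := by simp [hB]
  rw [h0, hb t ht]
  ring

/-- The Poincaré inequality on `(0, 1)` for functions vanishing at `0`, with any constant below
the sharp one. -/
lemma poincare_primitive {p : ℝ → ℝ} (hp : MemLp p 2 (volume.restrict (Ioc (0 : ℝ) 1))) {k : ℝ}
    (hk0 : 0 ≤ k) (hk : k < Real.pi / 2) :
    k ^ 2 * ∫ t in (0 : ℝ)..1, (∫ s in (0 : ℝ)..t, p s) ^ 2 ≤ ∫ t in (0 : ℝ)..1, p t ^ 2 := by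
  have hpi := intervalIntegrable_of_memLp hp
  set P : ℝ → ℝ := fun t => ∫ s in (0 : ℝ)..t, p s with hP
  have hPac : AbsolutelyContinuousOnInterval P 0 1 :=
    hpi.absolutelyContinuousOnInterval_intervalIntegral left_mem_uIcc
  set ψ : ℝ → ℝ := fun t => k * Real.tan (k * (1 - t)) with hψ
  have hcos : ∀ t ∈ uIcc (0 : ℝ) 1, Real.cos (k * (1 - t)) ≠ 0 := fun t ht => by
    rw [uIcc_of_le zero_le_one] at ht
    refine (Real.cos_pos_of_mem_Ioo ⟨?_, ?_⟩).ne'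
    · nlinarith [ht.1, ht.2, Real.pi_pos, mul_nonneg hk0 (sub_nonneg.2 ht.2)]
    · nlinarith [ht.1, ht.2, mul_nonneg hk0 ht.1]
  have hψac : AbsolutelyContinuousOnInterval ψ 0 1 := by
    refine ContDiffOn.absolutelyContinuousOnInterval fun t ht => ContDiffAt.contDiffWithinAt ?_
    have h1 : ContDiffAt ℝ 1 (fun t : ℝ => k * (1 - t)) t := by fun_prop
    exact contDiffAt_const.mul
      (ContDiffAt.comp (g := Real.tan) t (Real.contDiffAt_tan.2 (hcos t ht)) h1)
  have hψ' : ∀ t ∈ uIcc (0 : ℝ) 1, HasDerivAt ψ (-(k ^ 2 + ψ t ^ 2)) t := fun t ht => by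
    have h1 : HasDerivAt (fun t : ℝ => k * (1 - t)) (k * -1) t :=
      ((hasDerivAt_id t).const_sub 1).const_mul k
    refine (((Real.hasDerivAt_tan (hcos t ht)).comp t h1).const_mul k).congr_deriv ?_
    have e := Real.sin_sq_add_cos_sq (k * (1 - t))
    have := hcos t ht
    simp only [hψ, Real.tan_eq_sin_div_cos]
    field_simp
    linear_combination k ^ 2 * e
  have hibp := ((hψac.fun_mul (hPac.fun_mul hPac))).integral_eq_sub_of_ae_hasDerivAt
    (F' := fun t => -(k ^ 2 + ψ t ^ 2) * (P t * P t) + ψ t * (p t * P t + P t * p t)) (by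
    filter_upwards [ae_hasDerivAt_primitive hpi] with x hx hx1
    exact (hψ' x hx1).fun_mul ((hx hx1).fun_mul (hx hx1)))
  have hψ1 : ψ 1 = 0 := by simp [hψ]
  have hP0 : P 0 = 0 := by simp [hP]
  rw [hψ1, hP0] at hibp
  simp only [zero_mul, mul_zero, sub_zero] at hibp
  have hψP : ContinuousOn (fun t => ψ t * P t) (uIcc 0 1) :=
    hψac.continuousOn.mul hPac.continuousOn
  have i1 : IntervalIntegrable (fun t => p t ^ 2) volume 0 1 :=
    (intervalIntegrable_sq_iff_memLp hpi).2 hp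
  have i2 : IntervalIntegrable (fun t => k ^ 2 * P t ^ 2) volume 0 1 :=
    (continuousOn_const.mul (hPac.continuousOn.pow 2)).intervalIntegrable
  have i3 : IntervalIntegrable
      (fun t => -(k ^ 2 + ψ t ^ 2) * (P t * P t) + ψ t * (p t * P t + P t * p t)) volume 0 1 := by
    have c : ContinuousOn (fun t => -(k ^ 2 + ψ t ^ 2) * (P t * P t)) (uIcc 0 1) :=
      ((continuousOn_const.add (hψac.continuousOn.pow 2)).neg).mul
        (hPac.continuousOn.mul hPac.continuousOn)
    refine c.intervalIntegrable.add (((hpi.continuousOn_mul hψP).const_mul 2).congr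
      (fun t _ => ?_))
    ring
  have hnn : 0 ≤ ∫ t in (0 : ℝ)..1, (p t - ψ t * P t) ^ 2 :=
    intervalIntegral.integral_nonneg zero_le_one fun _ _ => sq_nonneg _
  have heq : ∫ t in (0 : ℝ)..1, (p t - ψ t * P t) ^ 2 =
      ∫ t in (0 : ℝ)..1, (p t ^ 2 - k ^ 2 * P t ^ 2 -
        (-(k ^ 2 + ψ t ^ 2) * (P t * P t) + ψ t * (p t * P t + P t * p t))) := by
    refine intervalIntegral.integral_congr fun t _ => ?_
    ring
  rw [heq, intervalIntegral.integral_sub (i1.sub i2) i3, intervalIntegral.integral_sub i1 i2,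
    hibp, intervalIntegral.integral_const_mul] at hnn
  linarith

end UnitInterval

section PrimitiveOperator

lemma abs_integral_Lp_le (u : Lp ℝ 2 (volume.restrict (Ioc (0 : ℝ) 1))) {s t : ℝ}
    (hs : s ∈ Icc (0 : ℝ) 1) (ht : t ∈ Icc (0 : ℝ) 1) :
    |∫ x in s..t, u x| ≤ √|s - t| * ‖u‖ := by
  wlog hst : s ≤ t generalizing s t
  · rw [intervalIntegral.integral_symm, abs_neg, abs_sub_comm]
    exact this ht hs (le_of_not_ge hst)
  have hsub : Ioc s t ⊆ Ioc (0 : ℝ) 1 := Ioc_subset_Ioc hs.1 ht.2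
  have hr : (volume.restrict (Ioc (0 : ℝ) 1)).restrict (Ioc s t) = volume.restrict (Ioc s t) := by
    rw [Measure.restrict_restrict measurableSet_Ioc, inter_eq_left.2 hsub]
  have hfin : volume.restrict (Ioc (0 : ℝ) 1) (Ioc s t) ≠ ⊤ := measure_ne_top _ _
  have hinner := L2.inner_indicatorConstLp_one (𝕜 := ℝ) measurableSet_Ioc hfin u
  rw [hr, ← intervalIntegral.integral_of_le hst] at hinner
  rw [← hinner]
  refine (abs_real_inner_le_norm _ _).trans (mul_le_mul_of_nonneg_right ?_ (norm_nonneg _))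
  rw [norm_indicatorConstLp two_ne_zero ENNReal.ofNat_ne_top, measureReal_def,
    Measure.restrict_apply measurableSet_Ioc, inter_eq_left.2 hsub, Real.volume_Ioc,
    ENNReal.toReal_ofReal (sub_nonneg.2 hst), abs_sub_comm, abs_of_nonneg (sub_nonneg.2 hst),
    Real.sqrt_eq_rpow]
  simp

lemma intervalIntegrable_Lp (u : Lp ℝ 2 (volume.restrict (Ioc (0 : ℝ) 1))) :
    IntervalIntegrable u volume 0 1 :=
  intervalIntegrable_of_memLp (Lp.memLp u)

lemma uIcc_zero_subset {t : ℝ} (ht : t ∈ Icc (0 : ℝ) 1) : uIcc 0 t ⊆ uIcc (0 : ℝ) 1 :=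
  uIcc_subset_uIcc_left (by rwa [uIcc_of_le zero_le_one])

lemma primitive_congr_ae {p q : ℝ → ℝ} (hpq : p =ᵐ[volume.restrict (Ioc (0 : ℝ) 1)] q) {t : ℝ}
    (ht : t ∈ Icc (0 : ℝ) 1) : ∫ s in (0 : ℝ)..t, p s = ∫ s in (0 : ℝ)..t, q s := by
  rw [intervalIntegral.integral_of_le ht.1, intervalIntegral.integral_of_le ht.1]
  exact integral_congr_ae
    (ae_mono (Measure.restrict_mono (Ioc_subset_Ioc_right ht.2) le_rfl) hpq)

/-- The primitive vanishing at `0`, as a bounded operator from `L²(0, 1)` to `C([0, 1])`. -/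
noncomputable def primitiveCLM : Lp ℝ 2 (volume.restrict (Ioc (0 : ℝ) 1)) →L[ℝ]
    BoundedContinuousFunction (Icc (0 : ℝ) 1) ℝ :=
  LinearMap.mkContinuous
    { toFun := fun u => BoundedContinuousFunction.mkOfCompact
        ⟨fun t => ∫ s in (0 : ℝ)..t, u s, by
          have h := ((intervalIntegrable_Lp u).absolutelyContinuousOnInterval_intervalIntegral
            (c := 0) left_mem_uIcc).continuousOn
          rw [uIcc_of_le zero_le_one] at h
          exact h.domRestrict⟩
      map_add' := fun u v => by
        ext ⟨t, ht⟩
        have hu := (intervalIntegrable_Lp u).mono_set (uIcc_zero_subset ht)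
        have hv := (intervalIntegrable_Lp v).mono_set (uIcc_zero_subset ht)
        exact (primitive_congr_ae (Lp.coeFn_add u v) ht).trans
          (intervalIntegral.integral_add hu hv)
      map_smul' := fun c u => by
        ext ⟨t, ht⟩
        exact (primitive_congr_ae (Lp.coeFn_smul c u) ht).trans
          (intervalIntegral.integral_smul c u) }
    1 fun u => by
      refine (BoundedContinuousFunction.norm_le (by positivity)).2 fun ⟨t, ht⟩ => ?_
      refine (abs_integral_Lp_le u ⟨le_rfl, zero_le_one⟩ ht).trans
        (mul_le_mul_of_nonneg_right ?_ (norm_nonneg _))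
      rw [Real.sqrt_le_one, zero_sub, abs_neg, abs_of_nonneg ht.1]
      exact ht.2

lemma primitiveCLM_apply (u : Lp ℝ 2 (volume.restrict (Ioc (0 : ℝ) 1))) (t : Icc (0 : ℝ) 1) :
    primitiveCLM u t = ∫ s in (0 : ℝ)..t, u s := rfl

lemma isCompactOperator_primitiveCLM : IsCompactOperator primitiveCLM := by
  refine (isCompactOperator_iff_isCompact_closure_image_closedBall
    (primitiveCLM.toLinearMap) zero_lt_one).2 ?_
  refine BoundedContinuousFunction.arzela_ascoli (Metric.closedBall (0 : ℝ) 1)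
    (isCompact_closedBall 0 1) _ ?_ ?_
  · rintro _ t ⟨u, hu, rfl⟩
    rw [mem_closedBall_zero_iff] at hu ⊢
    refine (BoundedContinuousFunction.norm_coe_le_norm _ t).trans ?_
    refine (ContinuousLinearMap.le_of_opNorm_le _
      (LinearMap.mkContinuous_norm_le _ zero_le_one _) u).trans ?_
    rwa [one_mul]
  · refine Metric.equicontinuous_of_continuity_modulus (fun r => √r) ?_ _ ?_
    · simpa using (Real.continuous_sqrt.tendsto 0)
    · rintro x y ⟨_, u, hu, rfl⟩
      rw [mem_closedBall_zero_iff] at hu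
      have hx := (intervalIntegrable_Lp u).mono_set (uIcc_zero_subset x.2)
      have hy := (intervalIntegrable_Lp u).mono_set (uIcc_zero_subset y.2)
      change |(∫ s in (0 : ℝ)..x, u s) - ∫ s in (0 : ℝ)..y, u s| ≤ √|(x : ℝ) - y|
      rw [intervalIntegral.integral_interval_sub_left hx hy, abs_sub_comm]
      exact (abs_integral_Lp_le u y.2 x.2).trans
        (mul_le_of_le_one_right (Real.sqrt_nonneg _) hu)

end PrimitiveOperator

section Sobolev

namespace H1L

lemma memLp (v : H1L) : MemLp v.f' 2 (volume.restrict (Ioc (0 : ℝ) 1)) :=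
  (intervalIntegrable_sq_iff_memLp v.int).1 v.sq

/-- The element of `H1L` with a given square integrable derivative. -/
noncomputable def ofMemLp (p : ℝ → ℝ) (hp : MemLp p 2 (volume.restrict (Ioc (0 : ℝ) 1))) : H1L where
  f t := ∫ s in (0 : ℝ)..t, p s
  f' := p
  int := intervalIntegrable_of_memLp hp
  sq := (intervalIntegrable_sq_iff_memLp (intervalIntegrable_of_memLp hp)).2 hp
  repr _ _ := rfl

lemma continuousOn (v : H1L) : ContinuousOn v.f (uIcc 0 1) := by
  refine (v.int.absolutelyContinuousOnInterval_intervalIntegral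
    (c := 0) left_mem_uIcc).continuousOn.congr fun t ht => ?_
  rw [uIcc_of_le zero_le_one] at ht
  exact v.repr t ht

lemma aestronglyMeasurable (v : H1L) :
    AEStronglyMeasurable v.f (volume.restrict (Ioc (0 : ℝ) 1)) := by
  have h := v.continuousOn
  rw [uIcc_of_le zero_le_one] at h
  exact (h.mono Ioc_subset_Icc_self).aestronglyMeasurable measurableSet_Ioc

lemma intervalIntegrable_mul (v w : H1L) :
    IntervalIntegrable (fun s => v.f' s * w.f' s) volume 0 1 :=
  intervalIntegrable_unit_iff.2 (v.memLp.integrable_mul w.memLp)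

lemma ofMemLp_sub_f (v w : H1L) {t : ℝ} (ht : t ∈ Icc (0 : ℝ) 1) :
    (ofMemLp _ (v.memLp.sub w.memLp)).f t = v.f t - w.f t := by
  rw [v.repr t ht, w.repr t ht]
  exact intervalIntegral.integral_sub (v.int.mono_set (uIcc_zero_subset ht))
    (w.int.mono_set (uIcc_zero_subset ht))

lemma ofMemLp_add_const_mul_f (v w : H1L) (c : ℝ) {t : ℝ} (ht : t ∈ Icc (0 : ℝ) 1) :
    (ofMemLp _ (v.memLp.add (w.memLp.const_mul c))).f t = v.f t + c * w.f t := by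
  rw [v.repr t ht, w.repr t ht, ← intervalIntegral.integral_const_mul]
  exact intervalIntegral.integral_add (v.int.mono_set (uIcc_zero_subset ht))
    ((w.int.mono_set (uIcc_zero_subset ht)).const_mul c)

end H1L

variable {h : ℝ × ℝ} {b : ℝ → ℝ}

lemma intervalIntegrable_edot_mvec
    (hb : AEStronglyMeasurable b (volume.restrict (Ioc (0 : ℝ) 1))) :
    IntervalIntegrable (fun s => edot h (mvec (b s))) volume 0 1 :=
  intervalIntegrable_unit_iff.2 <| Integrable.of_bound
    ((continuous_edot_mvec h).comp_aestronglyMeasurable hb) (enorm2 h)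
    (Eventually.of_forall fun _ => abs_edot_mvec_le h _)

lemma intervalIntegrable_edot_Dmvec
    (hb : AEStronglyMeasurable b (volume.restrict (Ioc (0 : ℝ) 1))) :
    IntervalIntegrable (fun s => edot h (Dmvec (b s))) volume 0 1 :=
  intervalIntegrable_unit_iff.2 <| Integrable.of_bound
    ((continuous_edot_Dmvec h).comp_aestronglyMeasurable hb) (enorm2 h)
    (Eventually.of_forall fun _ => abs_edot_Dmvec_le h _)

variable {α : ℝ → ℝ}

lemma energy_eq_sub (h : ℝ × ℝ) (hα : Measurable α) (v : H1L) :
    energy h α v = (∫ s in (0 : ℝ)..1, v.f' s ^ 2) / 2 -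
      ∫ s in (0 : ℝ)..1, edot h (mvec (v.f s + α s)) := by
  have hi : IntervalIntegrable (fun s => edot h (mvec (v.f s + α s))) volume 0 1 :=
    intervalIntegrable_edot_mvec (v.aestronglyMeasurable.add hα.aestronglyMeasurable)
  rw [energy, intervalIntegral.integral_sub (v.sq.div_const 2) hi,
    intervalIntegral.integral_div]

/-- The magnetic part of the energy, as a functional on `C([0, 1])`. -/
noncomputable def magneticEnergy (h : ℝ × ℝ) (α : ℝ → ℝ)
    (y : BoundedContinuousFunction (Icc (0 : ℝ) 1) ℝ) : ℝ :=
  ∫ s in (0 : ℝ)..1, edot h (mvec (y (projIcc 0 1 zero_le_one s) + α s))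

lemma aestronglyMeasurable_projIcc_add (hα : Measurable α)
    (y : BoundedContinuousFunction (Icc (0 : ℝ) 1) ℝ) :
    AEStronglyMeasurable (fun s => y (projIcc 0 1 zero_le_one s) + α s)
      (volume.restrict (Ioc (0 : ℝ) 1)) :=
  (y.continuous.comp continuous_projIcc).aestronglyMeasurable.add hα.aestronglyMeasurable

lemma lipschitzWith_magneticEnergy (h : ℝ × ℝ) (hα : Measurable α) :
    LipschitzWith (enorm2 h).toNNReal (magneticEnergy h α) := by
  refine LipschitzWith.of_dist_le_mul fun y z => ?_
  rw [Real.coe_toNNReal _ (enorm2_nonneg h), dist_eq_norm, magneticEnergy, magneticEnergy,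
    ← intervalIntegral.integral_sub
      (intervalIntegrable_edot_mvec (aestronglyMeasurable_projIcc_add hα y))
      (intervalIntegrable_edot_mvec (aestronglyMeasurable_projIcc_add hα z))]
  refine (intervalIntegral.norm_integral_le_of_norm_le_const (C := enorm2 h * dist y z)
    fun s _ => (abs_edot_mvec_sub_le h _ _).trans ?_).trans (by simp)
  rw [add_sub_add_right_eq_sub, ← Real.dist_eq]
  exact mul_le_mul_of_nonneg_left (BoundedContinuousFunction.dist_coe_le_dist _)
    (enorm2_nonneg h)

lemma magneticEnergy_le (h : ℝ × ℝ) (α : ℝ → ℝ)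
    (y : BoundedContinuousFunction (Icc (0 : ℝ) 1) ℝ) : magneticEnergy h α y ≤ enorm2 h := by
  have := intervalIntegral.norm_integral_le_of_norm_le_const (a := 0) (b := 1)
    (f := fun s => edot h (mvec (y (projIcc 0 1 zero_le_one s) + α s)))
    fun s _ => abs_edot_mvec_le h _
  rw [sub_zero, abs_one, mul_one] at this
  exact (le_abs_self _).trans this

lemma energy_eq_norm_sq_sub (h : ℝ × ℝ) (hα : Measurable α) {v : H1L}
    {u : Lp ℝ 2 (volume.restrict (Ioc (0 : ℝ) 1))}
    (hv : v.f' =ᵐ[volume.restrict (Ioc (0 : ℝ) 1)] u) :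
    energy h α v = ‖u‖ ^ 2 / 2 - magneticEnergy h α (primitiveCLM u) := by
  rw [energy_eq_sub h hα, magneticEnergy]
  congr 1
  · congr 1
    rw [integral_unit_eq, ← real_inner_self_eq_norm_sq u, L2.inner_def]
    refine integral_congr_ae ?_
    filter_upwards [hv] with s hs
    simp [hs, sq]
  · refine intervalIntegral.integral_congr fun s hs => ?_
    rw [uIcc_of_le zero_le_one] at hs
    simp only [primitiveCLM_apply, projIcc_of_mem zero_le_one hs]
    rw [v.repr s hs, primitive_congr_ae hv hs]

lemma exists_energy_minimizer (h : ℝ × ℝ) (hα : Measurable α) :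
    ∃ v : H1L, ∀ w : H1L, energy h α v ≤ energy h α w := by
  obtain ⟨u, hu⟩ := exists_minimizer_of_isCompactOperator primitiveCLM
    isCompactOperator_primitiveCLM (lipschitzWith_magneticEnergy h hα) (magneticEnergy_le h α)
  refine ⟨H1L.ofMemLp u (Lp.memLp u), fun w => ?_⟩
  rw [energy_eq_norm_sq_sub h hα (v := H1L.ofMemLp u (Lp.memLp u)) (u := u) EventuallyEq.rfl,
    energy_eq_norm_sq_sub h hα w.memLp.coeFn_toLp.symm]
  exact hu _

lemma isStateSol_of_energy_minimizer (hα : Measurable α) {v : H1L}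
    (hv : ∀ w : H1L, energy h α v ≤ energy h α w) : IsStateSol h α v := by
  intro w
  set A := (∫ s in (0 : ℝ)..1, v.f' s * w.f' s)
      - ∫ s in (0 : ℝ)..1, edot h (Dmvec (α s + v.f s)) * w.f s with hA
  set B := (∫ s in (0 : ℝ)..1, w.f' s ^ 2) / 2 + enorm2 h * ∫ s in (0 : ℝ)..1, w.f s ^ 2 with hB
  have hvα : AEStronglyMeasurable (fun s => α s + v.f s) (volume.restrict (Ioc (0 : ℝ) 1)) :=
    hα.aestronglyMeasurable.add v.aestronglyMeasurable
  have iD : IntervalIntegrable (fun s => edot h (Dmvec (α s + v.f s)) * w.f s) volume 0 1 :=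
    (intervalIntegrable_edot_Dmvec hvα).mul_continuousOn w.continuousOn
  have iw : IntervalIntegrable (fun s => w.f s ^ 2) volume 0 1 :=
    (w.continuousOn.pow 2).intervalIntegrable
  have key : ∀ t : ℝ, 0 ≤ t * A + t ^ 2 * B := fun t => by
    set z : H1L := H1L.ofMemLp _ (v.memLp.add (w.memLp.const_mul t)) with hz
    have h1 := hv z
    rw [energy_eq_sub h hα, energy_eq_sub h hα] at h1
    have h2 : ∫ s in (0 : ℝ)..1, z.f' s ^ 2 = (∫ s in (0 : ℝ)..1, v.f' s ^ 2) +
        2 * t * (∫ s in (0 : ℝ)..1, v.f' s * w.f' s) +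
        t ^ 2 * ∫ s in (0 : ℝ)..1, w.f' s ^ 2 := by
      have i2 := (v.intervalIntegrable_mul w).const_mul (2 * t)
      have i3 := w.sq.const_mul (t ^ 2)
      rw [← intervalIntegral.integral_const_mul, ← intervalIntegral.integral_const_mul,
        ← intervalIntegral.integral_add v.sq i2, ← intervalIntegral.integral_add (v.sq.add i2) i3]
      refine intervalIntegral.integral_congr fun s _ => ?_
      change (v.f' s + t * w.f' s) ^ 2 = _
      ring
    have iv : IntervalIntegrable (fun s => edot h (mvec (v.f s + α s))) volume 0 1 :=
      intervalIntegrable_edot_mvec (v.aestronglyMeasurable.add hα.aestronglyMeasurable)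
    have iz : IntervalIntegrable (fun s => edot h (mvec (z.f s + α s))) volume 0 1 :=
      intervalIntegrable_edot_mvec (z.aestronglyMeasurable.add hα.aestronglyMeasurable)
    have h3 : (∫ s in (0 : ℝ)..1, edot h (mvec (v.f s + α s))) +
        t * (∫ s in (0 : ℝ)..1, edot h (Dmvec (α s + v.f s)) * w.f s) -
        t ^ 2 * enorm2 h * (∫ s in (0 : ℝ)..1, w.f s ^ 2) ≤
        ∫ s in (0 : ℝ)..1, edot h (mvec (z.f s + α s)) := by
      have i2 := iD.const_mul t
      have i3 := iw.const_mul (t ^ 2 * enorm2 h)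
      rw [← intervalIntegral.integral_const_mul, ← intervalIntegral.integral_const_mul,
        ← intervalIntegral.integral_add iv i2, ← intervalIntegral.integral_sub (iv.add i2) i3]
      refine intervalIntegral.integral_mono_on zero_le_one ((iv.add i2).sub i3) iz fun s hs => ?_
      have hT := (abs_le.1 (abs_edot_mvec_taylor_le h (α s + v.f s) (t * w.f s))).1
      rw [hz, H1L.ofMemLp_add_const_mul_f v w t hs,
        show v.f s + t * w.f s + α s = α s + v.f s + t * w.f s by ring, add_comm (v.f s) (α s)]
      linarith
    rw [h2] at h1
    rw [hA, hB]
    linarith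
  have hB0 : 0 ≤ B := add_nonneg
    (div_nonneg (intervalIntegral.integral_nonneg zero_le_one fun _ _ => sq_nonneg _) zero_le_two)
    (mul_nonneg (enorm2_nonneg h)
      (intervalIntegral.integral_nonneg zero_le_one fun _ _ => sq_nonneg _))
  have h1 := key (-A / (2 * (B + 1)))
  have h2 : -A / (2 * (B + 1)) * A + (-A / (2 * (B + 1))) ^ 2 * B =
      -(A ^ 2 * (B + 2) / (4 * (B + 1) ^ 2)) := by
    field_simp
    ring
  rw [h2] at h1
  have h3 : A ^ 2 * (B + 2) ≤ 0 := by
    by_contra! hpos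
    have : 0 < A ^ 2 * (B + 2) / (4 * (B + 1) ^ 2) := by positivity
    linarith
  have h4 : A ^ 2 ≤ 0 := by nlinarith [sq_nonneg A]
  exact pow_eq_zero_iff two_ne_zero |>.1 (le_antisymm h4 (sq_nonneg A))

lemma IsStateSol.eq_of_enorm2_lt (hα : Measurable α) (hh : enorm2 h < Real.pi ^ 2 / 4) {v w : H1L}
    (hv : IsStateSol h α v) (hw : IsStateSol h α w) : ∀ t ∈ Icc (0 : ℝ) 1, v.f t = w.f t := by
  set d : H1L := H1L.ofMemLp _ (v.memLp.sub w.memLp) with hd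
  have hdf : ∀ t ∈ Icc (0 : ℝ) 1, d.f t = v.f t - w.f t := fun t ht => H1L.ofMemLp_sub_f v w ht
  have iD : ∀ u : H1L,
      IntervalIntegrable (fun s => edot h (Dmvec (α s + u.f s)) * d.f s) volume 0 1 := fun u =>
    (intervalIntegrable_edot_Dmvec
      (hα.aestronglyMeasurable.add u.aestronglyMeasurable)).mul_continuousOn d.continuousOn
  have id2 : IntervalIntegrable (fun s => d.f s ^ 2) volume 0 1 :=
    (d.continuousOn.pow 2).intervalIntegrable
  have h1 : ∫ s in (0 : ℝ)..1, d.f' s ^ 2 = (∫ s in (0 : ℝ)..1, v.f' s * d.f' s) -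
      ∫ s in (0 : ℝ)..1, w.f' s * d.f' s := by
    rw [← intervalIntegral.integral_sub (v.intervalIntegrable_mul d) (w.intervalIntegrable_mul d)]
    refine intervalIntegral.integral_congr fun s _ => ?_
    change (v.f' s - w.f' s) ^ 2 = v.f' s * (v.f' s - w.f' s) - w.f' s * (v.f' s - w.f' s)
    ring
  have h2 : (∫ s in (0 : ℝ)..1, edot h (Dmvec (α s + v.f s)) * d.f s) -
      (∫ s in (0 : ℝ)..1, edot h (Dmvec (α s + w.f s)) * d.f s) ≤
      enorm2 h * ∫ s in (0 : ℝ)..1, d.f s ^ 2 := by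
    rw [← intervalIntegral.integral_const_mul, ← intervalIntegral.integral_sub (iD v) (iD w)]
    refine intervalIntegral.integral_mono_on zero_le_one ((iD v).sub (iD w))
      (id2.const_mul _) fun s hs => ?_
    have hL := abs_edot_Dmvec_sub_le h (α s + v.f s) (α s + w.f s)
    rw [add_sub_add_left_eq_sub, ← hdf s hs] at hL
    rw [← sub_mul, ← sq_abs (d.f s), sq, ← mul_assoc]
    refine (le_abs_self _).trans ?_
    rw [abs_mul]
    exact mul_le_mul_of_nonneg_right hL (abs_nonneg _)
  have h3 : ∫ s in (0 : ℝ)..1, d.f' s ^ 2 ≤ enorm2 h * ∫ s in (0 : ℝ)..1, d.f s ^ 2 := by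
    have := hv d
    have := hw d
    linarith
  obtain ⟨k, hk1, hk2⟩ : ∃ k, √(enorm2 h) < k ∧ k < Real.pi / 2 := by
    refine exists_between ((Real.sqrt_lt' (by positivity)).2 ?_)
    convert hh using 1
    ring
  have hk0 : 0 < k := (Real.sqrt_nonneg _).trans_lt hk1
  have hk : enorm2 h < k ^ 2 := (Real.sqrt_lt' hk0).1 hk1
  have h4 : k ^ 2 * ∫ s in (0 : ℝ)..1, d.f s ^ 2 ≤ ∫ s in (0 : ℝ)..1, d.f' s ^ 2 :=
    poincare_primitive d.memLp hk0.le hk2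
  have h5 : 0 ≤ ∫ s in (0 : ℝ)..1, d.f s ^ 2 :=
    intervalIntegral.integral_nonneg zero_le_one fun _ _ => sq_nonneg _
  have h6 : ∫ s in (0 : ℝ)..1, d.f s ^ 2 = 0 := by nlinarith
  have h7 : ∫ s in (0 : ℝ)..1, d.f' s ^ 2 = 0 := by
    refine le_antisymm (by simpa [h6] using h3) ?_
    exact intervalIntegral.integral_nonneg zero_le_one fun _ _ => sq_nonneg _
  have h8 : d.f' =ᵐ[volume.restrict (Ioc (0 : ℝ) 1)] fun _ => 0 := by
    rw [integral_unit_eq, integral_eq_zero_iff_of_nonneg (fun _ => sq_nonneg _)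
      (intervalIntegrable_unit_iff.1 d.sq)] at h7
    filter_upwards [h7] with s hs using pow_eq_zero_iff two_ne_zero |>.1 hs
  intro t ht
  have h9 := d.repr t ht
  rw [primitive_congr_ae h8 ht, hdf t ht] at h9
  simpa [sub_eq_zero] using h9

lemma IsStateSol.ae_eq (hα : Measurable α) {v : H1L} (hv : IsStateSol h α v) :
    v.f' =ᵐ[volume.restrict (Ioc (0 : ℝ) 1)] fun t =>
      (∫ s in (0 : ℝ)..1, edot h (Dmvec (α s + v.f s))) -
        ∫ s in (0 : ℝ)..t, edot h (Dmvec (α s + v.f s)) := by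
  set g : ℝ → ℝ := fun s => edot h (Dmvec (α s + v.f s)) with hg
  have ig : IntervalIntegrable g volume 0 1 :=
    intervalIntegrable_edot_Dmvec (hα.aestronglyMeasurable.add v.aestronglyMeasurable)
  set U : ℝ → ℝ := fun t => (∫ s in (0 : ℝ)..1, g s) - ∫ s in (0 : ℝ)..t, g s with hU
  have hUc : ContinuousOn U (uIcc 0 1) := continuousOn_const.sub
    (ig.absolutelyContinuousOnInterval_intervalIntegral left_mem_uIcc).continuousOn
  have hULp : MemLp U 2 (volume.restrict (Ioc (0 : ℝ) 1)) :=
    (intervalIntegrable_sq_iff_memLp hUc.intervalIntegrable).1 (hUc.pow 2).intervalIntegrable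
  set d : H1L := H1L.ofMemLp _ (v.memLp.sub hULp) with hd
  have iUd : IntervalIntegrable (fun s => U s * d.f' s) volume 0 1 :=
    d.int.continuousOn_mul hUc
  have igd : IntervalIntegrable (fun s => g s * d.f s) volume 0 1 :=
    ig.mul_continuousOn d.continuousOn
  have iGd : IntervalIntegrable (fun t => (∫ s in (0 : ℝ)..t, g s) * d.f' t) volume 0 1 :=
    d.int.continuousOn_mul
      (ig.absolutelyContinuousOnInterval_intervalIntegral left_mem_uIcc).continuousOn
  have hibp : (∫ s in (0 : ℝ)..1, g s * d.f s) = ∫ s in (0 : ℝ)..1, U s * d.f' s := by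
    have h1 : (∫ t in (0 : ℝ)..1, (g t * d.f t + (∫ s in (0 : ℝ)..t, g s) * d.f' t)) =
        (∫ s in (0 : ℝ)..1, g s) * ∫ s in (0 : ℝ)..1, d.f' s :=
      integral_primitive_mul_add ig d.int
    rw [intervalIntegral.integral_add igd iGd] at h1
    have h2 : ∫ s in (0 : ℝ)..1, U s * d.f' s = (∫ s in (0 : ℝ)..1, g s) *
        (∫ s in (0 : ℝ)..1, d.f' s) - ∫ t in (0 : ℝ)..1, (∫ s in (0 : ℝ)..t, g s) * d.f' t := by
      rw [← intervalIntegral.integral_const_mul,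
        ← intervalIntegral.integral_sub (d.int.const_mul _) iGd]
      refine intervalIntegral.integral_congr fun s _ => ?_
      simp only [hU]
      ring
    linarith
  have h0 : ∫ s in (0 : ℝ)..1, d.f' s ^ 2 = 0 := by
    have h1 := hv d
    change (∫ s in (0 : ℝ)..1, v.f' s * d.f' s) - ∫ s in (0 : ℝ)..1, g s * d.f s = 0 at h1
    rw [hibp, ← intervalIntegral.integral_sub (v.intervalIntegrable_mul d) iUd] at h1
    refine Eq.trans (intervalIntegral.integral_congr fun s _ => ?_) h1
    change (v.f' s - U s) ^ 2 = v.f' s * (v.f' s - U s) - U s * (v.f' s - U s)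
    ring
  rw [integral_unit_eq, integral_eq_zero_iff_of_nonneg (fun _ => sq_nonneg _)
    (intervalIntegrable_unit_iff.1 d.sq)] at h0
  filter_upwards [h0] with s hs
  exact sub_eq_zero.1 (pow_eq_zero_iff two_ne_zero |>.1 hs)

lemma IsStateSol.inH3 (hα : Measurable α) {α' : ℝ → ℝ} (iα' : IntervalIntegrable α' volume 0 1)
    (iα'2 : IntervalIntegrable (fun s => α' s ^ 2) volume 0 1)
    (hα' : ∀ t ∈ Icc (0 : ℝ) 1, α t = α 0 + ∫ s in (0 : ℝ)..t, α' s) {v : H1L}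
    (hv : IsStateSol h α v) : InH3 v := by
  set g : ℝ → ℝ := fun s => edot h (Dmvec (α s + v.f s)) with hg
  have hβ : AEStronglyMeasurable (fun s => α s + v.f s) (volume.restrict (Ioc (0 : ℝ) 1)) :=
    hα.aestronglyMeasurable.add v.aestronglyMeasurable
  have ig : IntervalIntegrable g volume 0 1 := intervalIntegrable_edot_Dmvec hβ
  have iβ' : IntervalIntegrable (fun s => α' s + v.f' s) volume 0 1 := iα'.add v.int
  have hβ' : ∀ t ∈ Icc (0 : ℝ) 1,
      α t + v.f t = α 0 + v.f 0 + ∫ s in (0 : ℝ)..t, (α' s + v.f' s) := fun t ht => by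
    have hv0 : v.f 0 = 0 := by simpa using v.repr 0 ⟨le_rfl, zero_le_one⟩
    rw [intervalIntegral.integral_add (iα'.mono_set (uIcc_zero_subset ht))
      (v.int.mono_set (uIcc_zero_subset ht)), hα' t ht, v.repr t ht, hv0]
    ring
  have hLp : MemLp (fun s => edot h (mvec (α s + v.f s)) * (α' s + v.f' s)) 2
      (volume.restrict (Ioc (0 : ℝ) 1)) := by
    have hsum := ((intervalIntegrable_sq_iff_memLp iα').1 iα'2).add v.memLp
    refine hsum.of_le_mul (c := enorm2 h) (((continuous_edot_mvec h).comp_aestronglyMeasurable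
      hβ).mul hsum.aestronglyMeasurable) (Eventually.of_forall fun s => ?_)
    rw [norm_mul]
    exact mul_le_mul_of_nonneg_right (abs_edot_mvec_le h _) (norm_nonneg _)
  have iu3 := intervalIntegrable_of_memLp hLp
  have hLip : LipschitzWith (enorm2 h).toNNReal fun t => edot h (Dmvec t) :=
    LipschitzWith.of_dist_le_mul fun x y => by
      rw [Real.coe_toNNReal _ (enorm2_nonneg h)]
      exact abs_edot_Dmvec_sub_le h x y
  refine ⟨fun t => (∫ s in (0 : ℝ)..1, g s) - ∫ s in (0 : ℝ)..t, g s, fun s => -g s,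
    fun s => edot h (mvec (α s + v.f s)) * (α' s + v.f' s), ig.neg, iu3,
    (intervalIntegrable_sq_iff_memLp iu3).2 hLp, fun t ht => ?_, fun t ht => ?_, fun t ht => ?_⟩
  · rw [v.repr t ht, primitive_congr_ae (hv.ae_eq hα) ht]
  · simp
    ring
  · have := comp_eq_add_integral (hasDerivAt_edot_Dmvec h) hLip iβ' hβ' t ht
    simp only [neg_mul, intervalIntegral.integral_neg] at this
    simp only [hg]
    linarith

end Sobolev

/-- Corollary `cor:theta`: the magnetoelastic energy has a minimizer in
`H^1_{0L}(I)`; every minimizer weakly solves the state equation; if `|h| < c_p⁻² = π²/4`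
the weak solution is unique; and if `α ∈ H¹(I)` every weak solution is in `H³(I)`. -/
theorem energy_minimizer (h : ℝ × ℝ) (α : ℝ → ℝ) (hα : Measurable α) :
    (∃ v : H1L, ∀ w : H1L, energy h α v ≤ energy h α w) ∧
    (∀ v : H1L, (∀ w : H1L, energy h α v ≤ energy h α w) → IsStateSol h α v) ∧
    (enorm2 h < Real.pi ^ 2 / 4 →
      ∀ v w : H1L, IsStateSol h α v → IsStateSol h α w →
        ∀ t ∈ Icc (0 : ℝ) 1, v.f t = w.f t) ∧
    ((∃ α' : ℝ → ℝ, IntervalIntegrable α' volume 0 1 ∧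
        IntervalIntegrable (fun s => (α' s) ^ 2) volume 0 1 ∧
        ∀ t ∈ Icc (0 : ℝ) 1, α t = α 0 + ∫ s in (0 : ℝ)..t, α' s) →
      ∀ v : H1L, IsStateSol h α v → InH3 v) := by
  exact ⟨exists_energy_minimizer h hα, fun v hv => isStateSol_of_energy_minimizer hα hv,
    fun hh v w hv hw => hv.eq_of_enorm2_lt hα hh hw,
    fun ⟨_, iα', iα'2, hα'⟩ v hv => hv.inH3 hα iα' iα'2 hα'⟩
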